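/- Let τ > 1, κ > 0, C₀ > 0 and ν₀ > 0 be real constants, and let j ≥ 1, b ≥ 1 be integers. Let Γ be a symmetric j×j real matrix with λ_min(Γ) ≥ κ and |Γ_{k,l}| ≤ C₀(|k−l| + 1)^{−τ} for all 1 ≤ k, l ≤ j, and let ν ∈ ℝ^j with |ν| ≤ ν₀ (Euclidean norm). Let Γ^s be the banded truncation of Γ at bandwidth b. If (2C₀/(τ−1)) b^{1−τ} ≤ κ/2, then Γ^s is symmetric with λ_min(Γ^s) ≥ κ/2 (in particular invertible), and |Γ⁻¹ν − (Γ^s)⁻¹ν| ≤ (4C₀ ν₀/((τ−1) κ²)) b^{1−τ} in the Euclidean norm. -/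

import Mathlib

open MeasureTheory Matrix Finset in
/-- Euclidean (ℓ²) norm on `Fin j → ℝ`. -/
noncomputable def euclNorm {j : ℕ} (v : Fin j → ℝ) : ℝ := Real.sqrt (∑ k, (v k) ^ 2)

open Matrix in
/-- `quadLB A κ` : the quadratic form of `A` is bounded below by `κ·|v|²`.
For a symmetric matrix this says exactly that the smallest eigenvalue is at least `κ`. -/
def quadLB {j : ℕ} (A : Matrix (Fin j) (Fin j) ℝ) (κ : ℝ) : Prop :=
  ∀ v : Fin j → ℝ, κ * (∑ k, (v k) ^ 2) ≤ v ⬝ᵥ (A *ᵥ v)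

/-- ℓ²→ℓ² operator norm of a square real matrix. -/
noncomputable def opNorm {j : ℕ} (A : Matrix (Fin j) (Fin j) ℝ) : ℝ :=
  ‖(Matrix.toEuclideanCLM (𝕜 := ℝ) A : EuclideanSpace ℝ (Fin j) →L[ℝ] EuclideanSpace ℝ (Fin j))‖

/-- `Γ_j(t)` built from a local autocovariance function `γ`:
its `(k,l)` entry (1-based) is `γ t |k-l|`. -/
def gammaMat (γ : ℝ → ℕ → ℝ) (t : ℝ) (j : ℕ) : Matrix (Fin j) (Fin j) ℝ :=
  Matrix.of fun k l : Fin j => γ t ((k.1 : ℤ) - (l.1 : ℤ)).natAbs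

/-- `ν_j(t)` built from a local autocovariance function `γ`: its `k`-th entry (1-based)
is `γ t k`. -/
def gammaVec (γ : ℝ → ℕ → ℝ) (t : ℝ) (j : ℕ) : Fin j → ℝ := fun k => γ t (k.1 + 1)

/-- Banded truncation of a matrix at bandwidth `b`: keeps the entries with `|k-l| ≤ b`
and sets all others to zero. -/
def bandTrunc {j : ℕ} (A : Matrix (Fin j) (Fin j) ℝ) (b : ℕ) : Matrix (Fin j) (Fin j) ℝ :=
  Matrix.of fun k l : Fin j => if ((k.1 : ℤ) - (l.1 : ℤ)).natAbs ≤ b then A k l else 0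

open Real in
theorem rpow_neg_add_one_le_sub {τ : ℝ} (hτ : 1 < τ) {m : ℕ} (hm : 1 ≤ m) :
    ((m : ℝ) + 1) ^ (-τ) ≤
      (m : ℝ) ^ (1 - τ) / (τ - 1) - ((m + 1 : ℕ) : ℝ) ^ (1 - τ) / (τ - 1) := by
  have hτ0 : 0 < τ - 1 := by linarith
  have hm0 : (0 : ℝ) < m := by exact_mod_cast hm
  have hm1 : (0 : ℝ) < (m : ℝ) + 1 := by linarith
  have hlog : log (m / (m + 1)) ≤ -(1 / ((m : ℝ) + 1)) := by
    refine (log_le_sub_one_of_pos (div_pos hm0 hm1)).trans_eq ?_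
    field_simp
    ring
  have hratio : 1 + (τ - 1) * (1 / ((m : ℝ) + 1)) ≤ ((m : ℝ) / (m + 1)) ^ (1 - τ) := by
    rw [rpow_def_of_pos (div_pos hm0 hm1)]
    refine le_trans ?_ (add_one_le_exp _)
    nlinarith
  rw [div_rpow hm0.le hm1.le, le_div_iff₀ (rpow_pos_of_pos hm1 _)] at hratio
  have hpow : ((m : ℝ) + 1) ^ (-τ) = (m + 1 : ℝ) ^ (1 - τ) * (1 / ((m : ℝ) + 1)) := by
    rw [mul_one_div, ← rpow_sub_one hm1.ne']
    congr 1
    ring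
  rw [← sub_div, le_div_iff₀ hτ0, hpow]
  push_cast
  linarith

theorem sum_range_tail_rpow_le {τ : ℝ} (hτ : 1 < τ) {b : ℕ} (hb : 1 ≤ b) (n : ℕ) :
    ∑ m ∈ Finset.range n, (if m ≤ b then 0 else ((m : ℝ) + 1) ^ (-τ)) ≤
      (b : ℝ) ^ (1 - τ) / (τ - 1) := by
  have hτ0 : 0 < τ - 1 := by linarith
  suffices h : ∑ m ∈ Finset.range n, (if m ≤ b then 0 else ((m : ℝ) + 1) ^ (-τ)) +
      ((max n b : ℕ) : ℝ) ^ (1 - τ) / (τ - 1) ≤ (b : ℝ) ^ (1 - τ) / (τ - 1) by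
    have : 0 ≤ ((max n b : ℕ) : ℝ) ^ (1 - τ) / (τ - 1) := by positivity
    linarith
  induction n with
  | zero => simp
  | succ n ih =>
    rw [Finset.sum_range_succ]
    rcases lt_trichotomy n b with h | h | h
    · rw [max_eq_right h.le] at ih
      rw [max_eq_right (by omega), if_pos h.le]
      linarith
    · have key := rpow_neg_add_one_le_sub hτ (m := n) (by omega)
      have : 0 ≤ ((n : ℝ) + 1) ^ (-τ) := by positivity
      rw [max_eq_left h.ge] at ih
      rw [max_eq_left (by omega), if_pos h.le]
      linarith
    · have key := rpow_neg_add_one_le_sub hτ (m := n) (by omega)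
      rw [max_eq_left h.le] at ih
      rw [max_eq_left (by omega), if_neg (by omega)]
      linarith

theorem sum_natAbs_sub_le {f : ℕ → ℝ} (hf : ∀ m, 0 ≤ f m) {T : ℝ}
    (hT : ∀ n, ∑ m ∈ Finset.range n, f m ≤ T) {j : ℕ} (k : Fin j) :
    ∑ l : Fin j, f ((k.1 : ℤ) - (l.1 : ℤ)).natAbs ≤ 2 * T := by
  rw [Fin.sum_univ_eq_sum_range (fun l => f ((k.1 : ℤ) - (l : ℤ)).natAbs) j,
    ← Finset.sum_range_add_sum_Ico _ k.2.le, Finset.sum_Ico_eq_sum_range,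
    ← Finset.sum_range_reflect]
  have h₁ : ∑ l ∈ Finset.range k.1, f ((k.1 : ℤ) - ((k.1 - 1 - l : ℕ) : ℤ)).natAbs ≤ T := by
    refine le_trans ?_ (hT (k.1 + 1))
    rw [Finset.sum_range_succ']
    refine le_add_of_le_of_nonneg (Finset.sum_le_sum fun l hl => ?_) (hf 0)
    rw [Finset.mem_range] at hl
    exact le_of_eq (congrArg f (by omega))
  have h₂ : ∑ l ∈ Finset.range (j - k.1), f ((k.1 : ℤ) - ((k.1 + l : ℕ) : ℤ)).natAbs ≤ T := by
    refine le_trans (Finset.sum_le_sum fun l _ => ?_) (hT (j - k.1))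
    exact le_of_eq (congrArg f (by omega))
  linarith

open Matrix in
/-- Schur's test for a bilinear form, in additive form. -/
theorem abs_dotProduct_mulVec_le {j : ℕ} {E : Matrix (Fin j) (Fin j) ℝ} {δ : ℝ}
    (hrow : ∀ k, ∑ l, |E k l| ≤ δ) (hcol : ∀ l, ∑ k, |E k l| ≤ δ) (x y : Fin j → ℝ) :
    |x ⬝ᵥ (E *ᵥ y)| ≤ δ * (∑ k, x k ^ 2 + ∑ k, y k ^ 2) / 2 := by
  have hx : ∑ k, ∑ l, |E k l| * x k ^ 2 ≤ δ * ∑ k, x k ^ 2 := by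
    rw [Finset.mul_sum]
    refine Finset.sum_le_sum fun k _ => ?_
    rw [← Finset.sum_mul]
    exact mul_le_mul_of_nonneg_right (hrow k) (sq_nonneg _)
  have hy : ∑ k, ∑ l, |E k l| * y l ^ 2 ≤ δ * ∑ l, y l ^ 2 := by
    rw [Finset.mul_sum, Finset.sum_comm]
    refine Finset.sum_le_sum fun l _ => ?_
    rw [← Finset.sum_mul]
    exact mul_le_mul_of_nonneg_right (hcol l) (sq_nonneg _)
  have hxy : |x ⬝ᵥ (E *ᵥ y)| ≤ ∑ k, ∑ l, (|E k l| * x k ^ 2 + |E k l| * y l ^ 2) / 2 := by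
    simp only [dotProduct, mulVec, Finset.mul_sum]
    refine (Finset.abs_sum_le_sum_abs _ _).trans (Finset.sum_le_sum fun k _ => ?_)
    refine (Finset.abs_sum_le_sum_abs _ _).trans (Finset.sum_le_sum fun l _ => ?_)
    rw [abs_mul, abs_mul, ← sq_abs (x k), ← sq_abs (y l)]
    nlinarith [mul_nonneg (abs_nonneg (E k l)) (sq_nonneg (|x k| - |y l|))]
  simp only [← Finset.sum_div, Finset.sum_add_distrib] at hxy
  linarith

theorem euclNorm_nonneg {j : ℕ} (v : Fin j → ℝ) : 0 ≤ euclNorm v := Real.sqrt_nonneg _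

theorem euclNorm_sq {j : ℕ} (v : Fin j → ℝ) : euclNorm v ^ 2 = ∑ k, v k ^ 2 :=
  Real.sq_sqrt (Finset.sum_nonneg fun _ _ => sq_nonneg _)

open Matrix in
/-- Schur's test for the Euclidean operator norm. -/
theorem euclNorm_mulVec_le {j : ℕ} {E : Matrix (Fin j) (Fin j) ℝ} {δ : ℝ} (hδ : 0 < δ)
    (hrow : ∀ k, ∑ l, |E k l| ≤ δ) (hcol : ∀ l, ∑ k, |E k l| ≤ δ) (y : Fin j → ℝ) :
    euclNorm (E *ᵥ y) ≤ δ * euclNorm y := by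
  refine abs_le_of_sq_le_sq' ?_ (mul_nonneg hδ.le (euclNorm_nonneg y)) |>.2
  have h := (le_abs_self _).trans (abs_dotProduct_mulVec_le hrow hcol (E *ᵥ y) (δ • y))
  have h₁ : (E *ᵥ y) ⬝ᵥ (E *ᵥ (δ • y)) = δ * ∑ k, (E *ᵥ y) k ^ 2 := by
    rw [mulVec_smul, dotProduct_smul, smul_eq_mul]
    simp only [dotProduct, sq]
  have h₂ : ∑ k, (δ • y) k ^ 2 = δ ^ 2 * ∑ k, y k ^ 2 := by
    simp only [Pi.smul_apply, smul_eq_mul, mul_pow, Finset.mul_sum]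
  rw [h₁, h₂] at h
  rw [mul_pow, euclNorm_sq, euclNorm_sq]
  have : δ * ∑ k, (E *ᵥ y) k ^ 2 ≤ δ * (δ ^ 2 * ∑ k, y k ^ 2) := by linarith
  exact le_of_mul_le_mul_left this hδ

open Matrix in
theorem quadLB.mul_euclNorm_le {j : ℕ} {A : Matrix (Fin j) (Fin j) ℝ} {c : ℝ}
    (hA : quadLB A c) (v : Fin j → ℝ) : c * euclNorm v ≤ euclNorm (A *ᵥ v) := by
  rcases (euclNorm_nonneg v).eq_or_lt with h | h
  · rw [← h, mul_zero]
    exact euclNorm_nonneg _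
  · have h₁ : v ⬝ᵥ (A *ᵥ v) ≤ euclNorm v * euclNorm (A *ᵥ v) :=
      Real.sum_mul_le_sqrt_mul_sqrt _ _ _
    have h₂ := hA v
    rw [← euclNorm_sq] at h₂
    refine le_of_mul_le_mul_left ?_ h
    linarith

open Matrix in
theorem quadLB.isUnit {j : ℕ} {A : Matrix (Fin j) (Fin j) ℝ} {c : ℝ} (hc : 0 < c)
    (hA : quadLB A c) : IsUnit A := by
  rw [← mulVec_injective_iff_isUnit]
  intro x y hxy
  have h := hA (x - y)
  rw [mulVec_sub, sub_eq_zero.2 hxy, dotProduct_zero] at h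
  have h₀ : ∑ k, (x - y) k ^ 2 = 0 :=
    le_antisymm (by nlinarith) (Finset.sum_nonneg fun _ _ => sq_nonneg _)
  rw [Finset.sum_eq_zero_iff_of_nonneg fun _ _ => sq_nonneg _] at h₀
  ext k
  exact sub_eq_zero.1 (pow_eq_zero_iff two_ne_zero |>.1 (h₀ k (Finset.mem_univ k)))

theorem bandTrunc_isSymm {j : ℕ} {A : Matrix (Fin j) (Fin j) ℝ} (hA : A.IsSymm) (b : ℕ) :
    (bandTrunc A b).IsSymm := by
  ext k l
  simp only [bandTrunc, Matrix.transpose_apply, Matrix.of_apply, hA.apply]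
  rw [← Int.natAbs_neg, neg_sub]

theorem sum_abs_sub_bandTrunc_le {τ C₀ : ℝ} (hτ : 1 < τ) (hC₀ : 0 ≤ C₀) {j b : ℕ} (hb : 1 ≤ b)
    {Γ : Matrix (Fin j) (Fin j) ℝ}
    (hΓ : ∀ k l : Fin j, |Γ k l| ≤ C₀ * (|(k.1 : ℝ) - (l.1 : ℝ)| + 1) ^ (-τ)) (k : Fin j) :
    ∑ l, |(Γ - bandTrunc Γ b) k l| ≤ 2 * C₀ / (τ - 1) * (b : ℝ) ^ (1 - τ) := by
  have h := sum_natAbs_sub_le (f := fun m => if m ≤ b then 0 else ((m : ℝ) + 1) ^ (-τ))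
    (fun m => by positivity) (sum_range_tail_rpow_le hτ hb) k
  calc ∑ l, |(Γ - bandTrunc Γ b) k l|
      ≤ ∑ l : Fin j, C₀ * (if ((k.1 : ℤ) - (l.1 : ℤ)).natAbs ≤ b then 0 else
          ((((k.1 : ℤ) - (l.1 : ℤ)).natAbs : ℝ) + 1) ^ (-τ)) := by
        refine Finset.sum_le_sum fun l _ => ?_
        rw [Matrix.sub_apply, bandTrunc, Matrix.of_apply]
        split_ifs
        · simp
        · rw [sub_zero, Nat.cast_natAbs]
          push_cast
          exact hΓ k l
    _ ≤ C₀ * (2 * ((b : ℝ) ^ (1 - τ) / (τ - 1))) := by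
        rw [← Finset.mul_sum]
        exact mul_le_mul_of_nonneg_left h hC₀
    _ = 2 * C₀ / (τ - 1) * (b : ℝ) ^ (1 - τ) := by ring

open Matrix Real in
/-- if the banding error is at most `κ/2`, then the banded truncation `Γ^s`
is symmetric, has smallest eigenvalue at least `κ/2` (in particular it is invertible), and
`|Γ⁻¹ν - (Γ^s)⁻¹ν| ≤ (4C₀ν₀/((τ-1)κ²)) b^(1-τ)`. -/
theorem band_trunc_inverse (τ κ C₀ ν₀ : ℝ) (hτ : 1 < τ) (hκ : 0 < κ) (hC₀ : 0 < C₀)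
    (hν₀ : 0 < ν₀) (j b : ℕ) (hj : 1 ≤ j) (hb : 1 ≤ b)
    (Γ : Matrix (Fin j) (Fin j) ℝ) (hsym : Γ.IsSymm) (hmin : quadLB Γ κ)
    (hΓ : ∀ k l : Fin j, |Γ k l| ≤ C₀ * (|(k.1 : ℝ) - (l.1 : ℝ)| + 1) ^ (-τ))
    (ν : Fin j → ℝ) (hν : euclNorm ν ≤ ν₀)
    (hsmall : (2 * C₀ / (τ - 1)) * (b : ℝ) ^ ((1 : ℝ) - τ) ≤ κ / 2) :
    (bandTrunc Γ b).IsSymm ∧ quadLB (bandTrunc Γ b) (κ / 2) ∧ IsUnit (bandTrunc Γ b) ∧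
      euclNorm (fun k => (Γ⁻¹ *ᵥ ν) k - ((bandTrunc Γ b)⁻¹ *ᵥ ν) k) ≤
        (4 * C₀ * ν₀ / ((τ - 1) * κ ^ 2)) * (b : ℝ) ^ ((1 : ℝ) - τ) := by
  have hS := bandTrunc_isSymm hsym b
  have hτ0 : 0 < τ - 1 := by linarith
  have hb0 : (0 : ℝ) < b := by exact_mod_cast hb
  set S := bandTrunc Γ b with hSdef
  set δ := 2 * C₀ / (τ - 1) * (b : ℝ) ^ (1 - τ) with hδdef
  have hδ : 0 < δ := by positivity
  have hrow : ∀ k, ∑ l, |(Γ - S) k l| ≤ δ := sum_abs_sub_bandTrunc_le hτ hC₀.le hb hΓ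
  have hcol : ∀ l, ∑ k, |(Γ - S) k l| ≤ δ := fun l => by
    simpa only [(hsym.sub hS).apply] using hrow l
  have hquad : quadLB S (κ / 2) := fun v => by
    have h₁ := (le_abs_self _).trans (abs_dotProduct_mulVec_le hrow hcol v v)
    have h₂ := hmin v
    rw [sub_mulVec, dotProduct_sub] at h₁
    have h₃ := mul_le_mul_of_nonneg_right hsmall
      (Finset.sum_nonneg fun k _ => sq_nonneg (v k) : 0 ≤ ∑ k, v k ^ 2)
    linarith
  have hSunit := hquad.isUnit (by positivity)
  refine ⟨hS, hquad, hSunit, ?_⟩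
  have hΓunit := hmin.isUnit hκ
  set x := Γ⁻¹ *ᵥ ν with hx
  set y := S⁻¹ *ᵥ ν with hy
  have hΓx : Γ *ᵥ x = ν := by
    rw [hx, mulVec_mulVec, mul_nonsing_inv _ ((isUnit_iff_isUnit_det _).1 hΓunit), one_mulVec]
  have hSy : S *ᵥ y = ν := by
    rw [hy, mulVec_mulVec, mul_nonsing_inv _ ((isUnit_iff_isUnit_det _).1 hSunit), one_mulVec]
  have hdiff : Γ *ᵥ (x - y) = (Γ - S) *ᵥ (-y) := by
    rw [mulVec_sub, hΓx, sub_mulVec, mulVec_neg, mulVec_neg, hSy]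
    abel
  have hxy := hmin.mul_euclNorm_le (x - y)
  rw [hdiff] at hxy
  have hEy := euclNorm_mulVec_le hδ hrow hcol (-y)
  have hneg : euclNorm (-y) = euclNorm y := by simp [euclNorm]
  have hyν := hquad.mul_euclNorm_le y
  rw [hSy] at hyν
  have hybound : euclNorm y ≤ 2 * ν₀ / κ := by
    rw [le_div_iff₀ hκ]
    linarith
  have hfinal : κ * euclNorm (x - y) ≤ δ * (2 * ν₀ / κ) := by
    rw [hneg] at hEy
    exact (hxy.trans hEy).trans (mul_le_mul_of_nonneg_left hybound hδ.le)
  calc euclNorm (x - y) ≤ δ * (2 * ν₀ / κ) / κ := by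
        rw [le_div_iff₀ hκ]
        linarith
    _ = 4 * C₀ * ν₀ / ((τ - 1) * κ ^ 2) * (b : ℝ) ^ (1 - τ) := by
        rw [hδdef]
        field_simp
        ring
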